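/- arXiv:1502.07953 — 2 statements merged into one kernel-verified Lean document; each statement's English description precedes it below -/
import Mathlib

section
/- Let n > 1 be a squarefree integer with n ≡ 1 or 2 (mod 4). Then F̃(n) − F̃₁(n) = h(−4n). -/
open scoped Classical

/-- A classical binary quadratic form `(a, 2b, c)`, i.e. `a x² + 2 b x y + c y²`,
stored as the triple `(a, b, c)` of integers. -/
structure ClassicalForm where
  a : ℤ
  b : ℤ
  c : ℤ

namespace ClassicalForm

/-- The value `a x² + 2 b x y + c y²` of the form at `(x, y)`. -/
def eval (f : ClassicalForm) (x y : ℤ) : ℤ :=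
  f.a * x ^ 2 + 2 * f.b * x * y + f.c * y ^ 2

/-- The determinant `D = b² - a c` of the form `(a, 2b, c)`. -/
def det (f : ClassicalForm) : ℤ := f.b ^ 2 - f.a * f.c

/-- Positive definite: negative determinant and `a > 0`. -/
def PosDef (f : ClassicalForm) : Prop := f.det < 0 ∧ 0 < f.a

/-- The divisor `δ = gcd(a, b, c)` of the form `(a, 2b, c)`. -/
def divisor (f : ClassicalForm) : ℕ := Int.gcd (Int.gcd f.a f.b) f.c

/-- Primitive: divisor `gcd(a, b, c) = 1`. -/
def Primitive (f : ClassicalForm) : Prop := f.divisor = 1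

/-- A form of divisor `δ` is *uneven* if its primitive part `(a/δ, 2b/δ, c/δ)`
satisfies `gcd(a/δ, 2b/δ, c/δ) = 1` (i.e. `a/δ`, `c/δ` are not both even);
equivalently, `gcd(a, 2b, c) = gcd(a, b, c)`. -/
def Uneven (f : ClassicalForm) : Prop :=
  Int.gcd (Int.gcd f.a (2 * f.b)) f.c = f.divisor

/-- A form of divisor `δ` is *even* if its primitive part `(a/δ, 2b/δ, c/δ)`
has both outer coefficients even; equivalently `gcd(a, 2b, c) = 2 gcd(a, b, c)`. -/
def EvenForm (f : ClassicalForm) : Prop :=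
  Int.gcd (Int.gcd f.a (2 * f.b)) f.c = 2 * f.divisor

/-- Proper equivalence: `g` is obtained from `f` by a change of variables of
determinant `1` (i.e. with matrix in `SL₂(ℤ)`). -/
def Equiv (f g : ClassicalForm) : Prop :=
  ∃ p q r s : ℤ, p * s - q * r = 1 ∧
    ∀ x y : ℤ, g.eval x y = f.eval (p * x + q * y) (r * x + s * y)

end ClassicalForm

/-- The number of proper equivalence classes of forms in a set `S` of classical
forms (the sets used below are closed under proper equivalence). -/
noncomputable def classCount (S : Set ClassicalForm) : ℕ :=
  Nat.card (Quot (fun f g : S => ClassicalForm.Equiv f.1 g.1))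

/-- `F n`: the number of proper equivalence classes of positive definite uneven
forms (primitive or derived) of determinant `-n`. -/
noncomputable def F (n : ℕ) : ℕ :=
  classCount {f | f.det = -(n : ℤ) ∧ f.PosDef ∧ f.Uneven}

/-- `F₁ n`: the number of proper equivalence classes of positive definite even
forms (primitive or derived) of determinant `-n`. -/
noncomputable def F₁ (n : ℕ) : ℕ :=
  classCount {f | f.det = -(n : ℤ) ∧ f.PosDef ∧ f.EvenForm}

/-- `F̃ n`: the number of proper equivalence classes of positive definite
primitive uneven forms of determinant `-n`. -/
noncomputable def Ftil (n : ℕ) : ℕ :=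
  classCount {f | f.det = -(n : ℤ) ∧ f.PosDef ∧ f.Primitive ∧ f.Uneven}

/-- `F̃₁ n`: the number of proper equivalence classes of positive definite
primitive even forms of determinant `-n`. -/
noncomputable def Ftil₁ (n : ℕ) : ℕ :=
  classCount {f | f.det = -(n : ℤ) ∧ f.PosDef ∧ f.Primitive ∧ f.EvenForm}

/-- The weighted count `F(n)`: every class counts `1`, except that the class of
`(t, 0, t)` (of determinant `-t²`) counts `1/2`. -/
noncomputable def Fw (n : ℕ) : ℚ :=
  (F n : ℚ) - if ∃ t : ℕ, 0 < t ∧ n = t ^ 2 then 1 / 2 else 0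

/-- The weighted count `F₁(n)`: every class counts `1`, except that the class of
`(2t, 2t, 2t)` (of determinant `-3t²`) counts `1/3`. -/
noncomputable def F₁w (n : ℕ) : ℚ :=
  (F₁ n : ℚ) - if ∃ t : ℕ, 0 < t ∧ n = 3 * t ^ 2 then 2 / 3 else 0

/-- A modern binary quadratic form `a x² + b x y + c y²`. -/
structure ModernForm where
  a : ℤ
  b : ℤ
  c : ℤ

namespace ModernForm

/-- The value `a x² + b x y + c y²` of the form at `(x, y)`. -/
def eval (f : ModernForm) (x y : ℤ) : ℤ :=
  f.a * x ^ 2 + f.b * x * y + f.c * y ^ 2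

/-- The discriminant `Δ = b² - 4 a c`. -/
def disc (f : ModernForm) : ℤ := f.b ^ 2 - 4 * f.a * f.c

/-- Positive definite: negative discriminant and `a > 0`. -/
def PosDef (f : ModernForm) : Prop := f.disc < 0 ∧ 0 < f.a

/-- Primitive: `gcd(a, b, c) = 1`. -/
def Primitive (f : ModernForm) : Prop := Int.gcd (Int.gcd f.a f.b) f.c = 1

/-- `SL₂(ℤ)`-equivalence of modern forms. -/
def Equiv (f g : ModernForm) : Prop :=
  ∃ p q r s : ℤ, p * s - q * r = 1 ∧
    ∀ x y : ℤ, g.eval x y = f.eval (p * x + q * y) (r * x + s * y)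

end ModernForm

/-- The class number `h(Δ)`: the number of `SL₂(ℤ)`-equivalence classes of
primitive positive definite modern forms of discriminant `Δ`. -/
noncomputable def h (Δ : ℤ) : ℕ :=
  Nat.card (Quot (fun f g : {f : ModernForm // f.disc = Δ ∧ f.PosDef ∧ f.Primitive} =>
    ModernForm.Equiv f.1 g.1))

/-- `h_ω(Δ)`: equal to `h(Δ)` except `h_ω(-3) = 1/3` and `h_ω(-4) = 1/2`. -/
noncomputable def hω (Δ : ℤ) : ℚ :=
  if Δ = -3 then 1 / 3 else if Δ = -4 then 1 / 2 else (h Δ : ℚ)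

/-- The Hurwitz class number `H(n) = Σ_{t | f} h_ω(Δ/t²)`, where `Δ = -n = f² Δ₁`
with `Δ₁` a fundamental discriminant; equivalently, the sum of `h_ω(-(n/t²))`
over all `t ≥ 1` with `t² ∣ n` and `-(n/t²) ≡ 0` or `1 (mod 4)`. -/
noncomputable def Hur (n : ℕ) : ℚ :=
  ∑ t ∈ (Finset.Icc 1 n).filter (fun t =>
      t ^ 2 ∣ n ∧ ((-((n / t ^ 2 : ℕ) : ℤ)) % 4 = 0 ∨ (-((n / t ^ 2 : ℕ) : ℤ)) % 4 = 1)),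
    hω (-((n / t ^ 2 : ℕ) : ℤ))

/-- The classical form `(a, 2b, c)` regarded as a modern form. -/
def ClassicalForm.toModern (f : ClassicalForm) : ModernForm := ⟨f.a, 2 * f.b, f.c⟩

lemma ClassicalForm.toModern_eval (f : ClassicalForm) (x y : ℤ) :
    f.toModern.eval x y = f.eval x y := rfl

lemma ClassicalForm.toModern_disc (f : ClassicalForm) : f.toModern.disc = 4 * f.det := by
  simp only [toModern, ModernForm.disc, det]
  ring

lemma ClassicalForm.toModern_posDef_iff (f : ClassicalForm) :
    f.toModern.PosDef ↔ f.PosDef := by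
  simp only [ModernForm.PosDef, PosDef, toModern_disc]
  refine and_congr_left fun _ => ?_
  constructor <;> intro hf <;> linarith

lemma ClassicalForm.toModern_primitive_iff (f : ClassicalForm) :
    f.toModern.Primitive ↔ f.Primitive ∧ f.Uneven := by
  have hdvd : f.divisor ∣ Int.gcd (Int.gcd f.a (2 * f.b)) f.c :=
    Int.gcd_dvd_gcd_of_dvd_left _
      (Int.natCast_dvd_natCast.2 (Int.gcd_dvd_gcd_of_dvd_right _ (dvd_mul_left _ _)))
  simp only [ModernForm.Primitive, toModern, Primitive, Uneven]
  constructor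
  · intro hf
    rw [hf, Nat.dvd_one] at hdvd
    exact ⟨hdvd, hf.trans hdvd.symm⟩
  · rintro ⟨hf, hu⟩
    exact hu.trans hf

lemma ClassicalForm.toModern_injective : Function.Injective ClassicalForm.toModern := by
  rintro ⟨a, b, c⟩ ⟨a', b', c'⟩ hf
  simpa [toModern] using hf

lemma ModernForm.exists_toModern_eq (f : ModernForm) (hf : 4 ∣ f.disc) :
    ∃ g : ClassicalForm, g.toModern = f := by
  have hb : Even f.b := by
    have h4 : (4 : ℤ) ∣ f.b ^ 2 := by
      have : f.b ^ 2 = f.disc + 4 * (f.a * f.c) := by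
        simp only [disc]
        ring
      rw [this]
      exact dvd_add hf (dvd_mul_right _ _)
    have h2 : Even (f.b ^ 2) := even_iff_two_dvd.2 (dvd_trans (by norm_num) h4)
    exact (Int.even_pow.1 h2).1
  obtain ⟨b, hb⟩ := even_iff_exists_two_mul.1 hb
  exact ⟨⟨f.a, b, f.c⟩, by simp [ClassicalForm.toModern, ← hb]⟩

/-- Primitive uneven classes of determinant `-n` are the classes of discriminant `-4n`. -/
lemma Ftil_eq_h (n : ℕ) : Ftil n = h (-4 * (n : ℤ)) := by
  have key (f : ClassicalForm) :
      (f.det = -(n : ℤ) ∧ f.PosDef ∧ f.Primitive ∧ f.Uneven) ↔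
        f.toModern.disc = -4 * (n : ℤ) ∧ f.toModern.PosDef ∧ f.toModern.Primitive := by
    rw [f.toModern_disc, f.toModern_posDef_iff, f.toModern_primitive_iff]
    refine and_congr_left fun _ => ?_
    constructor <;> intro hf <;> linarith
  let φ : {f : ClassicalForm | f.det = -(n : ℤ) ∧ f.PosDef ∧ f.Primitive ∧ f.Uneven} →
      {f : ModernForm // f.disc = -4 * (n : ℤ) ∧ f.PosDef ∧ f.Primitive} :=
    fun f => ⟨f.1.toModern, (key f.1).1 f.2⟩
  have hφ : Function.Bijective φ := by
    constructor
    · intro f g hfg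
      exact Subtype.ext (ClassicalForm.toModern_injective (congrArg Subtype.val hfg))
    · rintro ⟨f, hf⟩
      obtain ⟨g, rfl⟩ := f.exists_toModern_eq (by rw [hf.1]; exact ⟨-n, by ring⟩)
      exact ⟨⟨g, (key g).2 hf⟩, rfl⟩
  exact Nat.card_congr (Quot.congr (Equiv.ofBijective φ hφ) fun _ _ => Iff.rfl)

lemma ClassicalForm.det_emod_four_of_primitive_of_even {f : ClassicalForm}
    (hp : f.Primitive) (he : f.EvenForm) : f.det % 4 = 1 := by
  unfold Primitive at hp
  unfold EvenForm at he
  rw [hp, mul_one] at he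
  have hc : (2 : ℤ) ∣ f.c := by
    have := Int.gcd_dvd_right (Int.gcd f.a (2 * f.b) : ℤ) f.c
    rwa [he] at this
  have ha : (2 : ℤ) ∣ f.a := by
    have := Int.gcd_dvd_left (Int.gcd f.a (2 * f.b) : ℤ) f.c
    rw [he] at this
    exact this.trans (Int.gcd_dvd_left _ _)
  have hb : Odd f.b := by
    rw [← Int.not_even_iff_odd, even_iff_two_dvd]
    intro hb
    have := Int.dvd_coe_gcd (Int.dvd_coe_gcd ha hb) hc
    rw [show Int.gcd (Int.gcd f.a f.b) f.c = 1 from hp] at this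
    norm_num at this
  obtain ⟨a, ha⟩ := ha
  obtain ⟨c, hc⟩ := hc
  obtain ⟨b, hb⟩ := hb
  have : f.det = 1 + 4 * (b ^ 2 + b - a * c) := by
    rw [det, ha, hb, hc]
    ring
  omega

lemma Ftil₁_eq_zero {n : ℕ} (hmod : n % 4 ≠ 3) : Ftil₁ n = 0 := by
  have : IsEmpty {f : ClassicalForm |
      f.det = -(n : ℤ) ∧ f.PosDef ∧ f.Primitive ∧ f.EvenForm} := by
    constructor
    rintro ⟨f, hd, -, hp, he⟩
    have := ClassicalForm.det_emod_four_of_primitive_of_even hp he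
    omega
  have : IsEmpty (Quot fun f g : {f : ClassicalForm |
      f.det = -(n : ℤ) ∧ f.PosDef ∧ f.Primitive ∧ f.EvenForm} =>
        ClassicalForm.Equiv f.1 g.1) :=
    ⟨fun q => Quot.ind (β := fun _ => False) (fun f => isEmptyElim f) q⟩
  exact Nat.card_of_isEmpty

/-- for squarefree `n > 1` with `n ≡ 1` or `2 (mod 4)`,
`F̃(n) - F̃₁(n) = h(-4n)`. -/
theorem Ftil_sub_Ftil₁_eq_h (n : ℕ) (hn : 1 < n) (hsf : Squarefree n)
    (hmod : n % 4 = 1 ∨ n % 4 = 2) :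
    (Ftil n : ℤ) - (Ftil₁ n : ℤ) = (h (-4 * (n : ℤ)) : ℤ) := by
  rw [Ftil_eq_h, Ftil₁_eq_zero (by omega), Nat.cast_zero, sub_zero]
end

section
/- Let n be a positive integer with n ≢ 0 (mod 4), and let F(n), F₁(n) be the weighted class counts. Then: if n ≡ 1 or 2 (mod 4), F(n) − F₁(n) = H(4n); if n ≡ 3 (mod 8), F(n) − F₁(n) = 2 H(n); and if n ≡ 7 (mod 8), F(n) − F₁(n) = 0, where H denotes the Hurwitz class number. -/
open scoped Classical

namespace ModernForm

/-- The form `f (p x + q y, r x + s y)`. -/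
def act (f : ModernForm) (p q r s : ℤ) : ModernForm :=
  ⟨f.eval p r, 2 * f.a * p * q + f.b * (p * s + q * r) + 2 * f.c * r * s, f.eval q s⟩

/-- The form `k f`. -/
def scale (k : ℤ) (f : ModernForm) : ModernForm := ⟨k * f.a, k * f.b, k * f.c⟩

/-- The form `f (x, 2 y)`. -/
def double (f : ModernForm) : ModernForm := ⟨f.a, 2 * f.b, 4 * f.c⟩

/-- The content `gcd (a, b, c)`. -/
def content (f : ModernForm) : ℕ := Int.gcd (Int.gcd f.a f.b) f.c

theorem eq_of_coeff {f g : ModernForm} (ha : f.a = g.a) (hb : f.b = g.b) (hc : f.c = g.c) :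
    f = g := by
  cases f; cases g; simp_all

theorem eq_of_eval {f g : ModernForm} (hfg : ∀ x y, f.eval x y = g.eval x y) : f = g := by
  have h₁ := hfg 1 0
  have h₂ := hfg 0 1
  have h₃ := hfg 1 1
  simp only [eval] at h₁ h₂ h₃
  apply eq_of_coeff <;> linarith

theorem eval_act (f : ModernForm) (p q r s x y : ℤ) :
    (f.act p q r s).eval x y = f.eval (p * x + q * y) (r * x + s * y) := by
  simp only [act, eval]; ring

theorem eval_scale (k : ℤ) (f : ModernForm) (x y : ℤ) :
    (f.scale k).eval x y = k * f.eval x y := by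
  simp only [scale, eval]; ring

theorem act_act (f : ModernForm) (p q r s p' q' r' s' : ℤ) :
    (f.act p q r s).act p' q' r' s' =
      f.act (p * p' + q * r') (p * q' + q * s') (r * p' + s * r') (r * q' + s * s') := by
  apply eq_of_eval
  intro x y
  simp only [eval_act]
  congr 1 <;> ring

theorem act_one (f : ModernForm) : f.act 1 0 0 1 = f := by
  apply eq_of_coeff <;> simp [act, eval]

theorem equiv_iff {f g : ModernForm} :
    Equiv f g ↔ ∃ p q r s : ℤ, p * s - q * r = 1 ∧ g = f.act p q r s := by
  constructor
  · rintro ⟨p, q, r, s, hd, hfg⟩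
    exact ⟨p, q, r, s, hd, eq_of_eval fun x y => by rw [hfg, eval_act]⟩
  · rintro ⟨p, q, r, s, hd, rfl⟩
    exact ⟨p, q, r, s, hd, fun x y => eval_act ..⟩

theorem equiv_act (f : ModernForm) {p q r s : ℤ} (hd : p * s - q * r = 1) :
    Equiv f (f.act p q r s) := equiv_iff.2 ⟨p, q, r, s, hd, rfl⟩

theorem equiv_equivalence : Equivalence Equiv where
  refl f := by simpa [act_one] using f.equiv_act (p := 1) (q := 0) (r := 0) (s := 1) (by norm_num)
  symm {f g} hfg := by
    obtain ⟨p, q, r, s, hd, rfl⟩ := equiv_iff.1 hfg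
    refine equiv_iff.2 ⟨s, -q, -r, p, by linarith, ?_⟩
    rw [act_act]
    conv_lhs => rw [← act_one f]
    congr 1 <;> linarith
  trans {f g k} hfg hgk := by
    obtain ⟨p, q, r, s, hd, rfl⟩ := equiv_iff.1 hfg
    obtain ⟨p', q', r', s', hd', rfl⟩ := equiv_iff.1 hgk
    rw [act_act]
    apply equiv_act
    linear_combination (p' * s' - q' * r') * hd + hd'

theorem disc_act (f : ModernForm) {p q r s : ℤ} (hd : p * s - q * r = 1) :
    (f.act p q r s).disc = f.disc := by
  have : (f.act p q r s).disc = f.disc * (p * s - q * r) ^ 2 := by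
    simp only [act, disc, eval]; ring
  rw [this, hd]; ring

theorem disc_double (f : ModernForm) : f.double.disc = 4 * f.disc := by
  simp only [double, disc]; ring

theorem disc_scale (k : ℤ) (f : ModernForm) : (f.scale k).disc = k ^ 2 * f.disc := by
  simp only [scale, disc]; ring

theorem dvd_content {d : ℤ} {f : ModernForm} :
    d ∣ f.content ↔ d ∣ f.a ∧ d ∣ f.b ∧ d ∣ f.c := by
  rw [content, Int.dvd_coe_gcd_iff, Int.dvd_coe_gcd_iff, and_assoc]

theorem content_dvd_act (f : ModernForm) (p q r s : ℤ) :
    f.content ∣ (f.act p q r s).content := by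
  obtain ⟨ha, hb, hc⟩ := dvd_content.1 (dvd_refl (f.content : ℤ))
  rw [← Int.natCast_dvd_natCast, dvd_content]
  have key : ∀ x y z : ℤ, (f.content : ℤ) ∣ f.a * x + f.b * y + f.c * z := fun x y z =>
    dvd_add (dvd_add (ha.mul_right _) (hb.mul_right _)) (hc.mul_right _)
  refine ⟨?_, ?_, ?_⟩
  · convert key (p ^ 2) (p * r) (r ^ 2) using 1; simp only [act, eval]; ring
  · convert key (2 * p * q) (p * s + q * r) (2 * r * s) using 1; simp only [act]; ring
  · convert key (q ^ 2) (q * s) (s ^ 2) using 1; simp only [act, eval]; ring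

theorem Equiv.disc_eq {f g : ModernForm} (hfg : Equiv f g) : g.disc = f.disc := by
  obtain ⟨p, q, r, s, hd, rfl⟩ := equiv_iff.1 hfg
  exact disc_act f hd

theorem Equiv.content_eq {f g : ModernForm} (hfg : Equiv f g) : g.content = f.content := by
  have key : ∀ {f g : ModernForm}, Equiv f g → f.content ∣ g.content := by
    intro f g hfg
    obtain ⟨p, q, r, s, -, rfl⟩ := equiv_iff.1 hfg
    exact content_dvd_act ..
  exact Nat.dvd_antisymm (key (equiv_equivalence.symm hfg)) (key hfg)

theorem Equiv.posDef {f g : ModernForm} (hfg : Equiv f g) (hf : f.PosDef) : g.PosDef := by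
  refine ⟨hfg.disc_eq ▸ hf.1, ?_⟩
  obtain ⟨p, q, r, s, hd, rfl⟩ := equiv_iff.1 hfg
  obtain ⟨hD, ha⟩ := hf
  have h₁ : 4 * f.a * f.eval p r = (2 * f.a * p + f.b * r) ^ 2 + (-f.disc) * r ^ 2 := by
    simp only [eval, disc]; ring
  have h₂ : 0 < (2 * f.a * p + f.b * r) ^ 2 + (-f.disc) * r ^ 2 := by
    rcases eq_or_ne r 0 with rfl | hr
    · have hp : p ≠ 0 := by rintro rfl; simp at hd
      have : 0 < (2 * f.a * p) ^ 2 := by positivity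
      simpa using this
    · have : 0 < r ^ 2 := by positivity
      nlinarith [sq_nonneg (2 * f.a * p + f.b * r), mul_pos (neg_pos.2 hD) this]
  rw [← h₁] at h₂
  exact pos_of_mul_pos_right h₂ (by linarith)

/-- Primitive positive definite forms of discriminant `Δ`. -/
abbrev Prim (Δ : ℤ) := {f : ModernForm // f.disc = Δ ∧ f.PosDef ∧ f.Primitive}

theorem Equiv.prim {Δ : ℤ} {f g : ModernForm} (hfg : Equiv f g)
    (hf : f.disc = Δ ∧ f.PosDef ∧ f.Primitive) : g.disc = Δ ∧ g.PosDef ∧ g.Primitive :=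
  ⟨hfg.disc_eq.trans hf.1, hfg.posDef hf.2.1, hfg.content_eq.trans hf.2.2⟩

theorem quot_eq_iff {P : ModernForm → Prop} {f g : {f // P f}} :
    Quot.mk (fun f g : {f // P f} => Equiv f.1 g.1) f = Quot.mk _ g ↔ Equiv f.1 g.1 :=
  Equivalence.quot_mk_eq_iff (r := fun f g : {f // P f} => Equiv f.1 g.1)
    (equiv_equivalence.comap Subtype.val) f g

theorem exists_translate (f : ModernForm) (ha : 0 < f.a) :
    ∃ g, Equiv f g ∧ g.a = f.a ∧ |g.b| ≤ g.a := by
  refine ⟨f.act 1 (-((f.b + f.a) / (2 * f.a))) 0 1, f.equiv_act (by ring), by simp [act, eval], ?_⟩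
  have h₁ := Int.emod_add_mul_ediv (f.b + f.a) (2 * f.a)
  have h₂ := Int.emod_nonneg (f.b + f.a) (b := 2 * f.a) (by lia)
  have h₃ := Int.emod_lt_of_pos (f.b + f.a) (b := 2 * f.a) (by lia)
  simp only [act, eval, abs_le]
  constructor <;> nlinarith

/-- Every positive definite form is properly equivalent to a form with `|b| ≤ a ≤ c`. -/
theorem exists_reduced (f : ModernForm) (hf : f.PosDef) :
    ∃ g, Equiv f g ∧ |g.b| ≤ g.a ∧ g.a ≤ g.c := by
  induction hN : f.a.toNat using Nat.strong_induction_on generalizing f with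
  | _ N ih =>
    obtain ⟨g, hfg, hga, hgb⟩ := f.exists_translate hf.2
    by_cases hgc : g.a ≤ g.c
    · exact ⟨g, hfg, hgb, hgc⟩
    have hgk : Equiv g (g.act 0 (-1) 1 0) := g.equiv_act (by ring)
    have hk := hgk.posDef (hfg.posDef hf)
    have hka : (g.act 0 (-1) 1 0).a = g.c := by simp [act, eval]
    have hk₂ := hk.2
    obtain ⟨l, hkl, hl⟩ := ih _ (by lia) _ hk rfl
    exact ⟨l, equiv_equivalence.trans hfg (equiv_equivalence.trans hgk hkl), hl⟩

theorem reduced_le {f : ModernForm} (hb : |f.b| ≤ f.a) (hc : f.a ≤ f.c) :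
    3 * (f.a * f.c) ≤ -f.disc := by
  have h₁ : f.b ^ 2 ≤ f.a * f.c := by
    rw [← sq_abs]
    nlinarith [abs_nonneg f.b]
  simp only [disc]
  linarith

instance finite_quot (Δ : ℤ) : Finite (Quot fun f g : Prim Δ => Equiv f.1 g.1) := by
  let box : Set ModernForm := (fun t : ℤ × ℤ × ℤ => ⟨t.1, t.2.1, t.2.2⟩) ''
    (Set.Icc 0 (-Δ) ×ˢ Set.Icc Δ (-Δ) ×ˢ Set.Icc 0 (-Δ))
  have hbox : box.Finite :=
    ((Set.finite_Icc _ _).prod ((Set.finite_Icc _ _).prod (Set.finite_Icc _ _))).image _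
  have : Finite {f : Prim Δ // f.1 ∈ box} :=
    (hbox.preimage Subtype.val_injective.injOn).to_subtype
  refine Finite.of_surjective (fun f : {f : Prim Δ // f.1 ∈ box} => Quot.mk _ f.1) ?_
  rintro ⟨f, hf⟩
  obtain ⟨g, hfg, hb, hc⟩ := f.exists_reduced hf.2.1
  have hg := hfg.prim hf
  refine ⟨⟨⟨g, hg⟩, ⟨g.a, g.b, g.c⟩, ?_, rfl⟩, quot_eq_iff.2 (equiv_equivalence.symm hfg)⟩
  have h₁ := reduced_le hb hc
  have ha := hg.2.1.2
  rw [hg.1] at h₁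
  have h₂ : g.a ≤ g.a * g.c := by nlinarith
  have h₃ : g.c ≤ g.a * g.c := by nlinarith
  have := abs_le.1 hb
  simp only [Set.mem_prod, Set.mem_Icc]
  refine ⟨⟨?_, ?_⟩, ⟨?_, ?_⟩, ?_, ?_⟩ <;> linarith

theorem h_eq_one {Δ : ℤ} (f : ModernForm) (hf : f.disc = Δ ∧ f.PosDef ∧ f.Primitive)
    (hred : ∀ g : ModernForm, (g.disc = Δ ∧ g.PosDef ∧ g.Primitive) → |g.b| ≤ g.a → g.a ≤ g.c →
      Equiv g f) : h Δ = 1 := by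
  rw [h, Nat.card_eq_one_iff_exists]
  refine ⟨Quot.mk _ ⟨f, hf⟩, ?_⟩
  rintro ⟨k, hk⟩
  obtain ⟨g, hkg, hb, hc⟩ := k.exists_reduced hk.2.1
  exact quot_eq_iff.2 (equiv_equivalence.trans hkg (hred g (hkg.prim hk) hb hc))

theorem h_neg_three : h (-3) = 1 := by
  refine h_eq_one ⟨1, 1, 1⟩ ⟨by norm_num [disc], by norm_num [PosDef, disc], by
    norm_num [Primitive]⟩ ?_
  rintro ⟨a, b, c⟩ ⟨hD, hp, -⟩ hb hc
  have h₁ := reduced_le hb hc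
  rw [hD] at h₁
  have ha := hp.2
  simp only [disc] at *
  obtain rfl : a = 1 := by nlinarith
  obtain rfl : c = 1 := by nlinarith
  obtain rfl | rfl : b = 1 ∨ b = -1 := mul_self_eq_one_iff.1 (by linarith)
  · exact equiv_equivalence.refl _
  · refine equiv_iff.2 ⟨1, 1, 0, 1, by norm_num, ?_⟩
    norm_num [act, eval]

theorem h_neg_four : h (-4) = 1 := by
  refine h_eq_one ⟨1, 0, 1⟩ ⟨by norm_num [disc], by norm_num [PosDef, disc], by
    norm_num [Primitive]⟩ ?_
  rintro ⟨a, b, c⟩ ⟨hD, hp, -⟩ hb hc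
  have h₁ := reduced_le hb hc
  rw [hD] at h₁
  have ha := hp.2
  simp only [disc] at *
  obtain rfl : a = 1 := by nlinarith
  obtain rfl : c = 1 := by nlinarith
  obtain rfl : b = 0 := by nlinarith
  exact equiv_equivalence.refl _

theorem h_neg_twelve : h (-12) = 1 := by
  refine h_eq_one ⟨1, 0, 3⟩ ⟨by norm_num [disc], by norm_num [PosDef, disc], by
    norm_num [Primitive]⟩ ?_
  rintro ⟨a, b, c⟩ ⟨hD, hp, hprim⟩ hb hc
  have h₁ := reduced_le hb hc
  rw [hD] at h₁
  have ha := hp.2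
  simp only [disc, Primitive] at *
  have ha₂ : a ≤ 2 := by nlinarith
  have hc₂ : c ≤ 4 := by nlinarith
  have hb' := abs_le.1 hb
  obtain ⟨hb₁, hb₂⟩ := hb'
  have hb₃ : b ≤ 2 := by linarith
  have hb₄ : -2 ≤ b := by linarith
  interval_cases a <;> interval_cases c <;> interval_cases b <;> simp_all
  exact equiv_equivalence.refl _

theorem primitive_of_dvd {f : ModernForm} (hf : ∀ d : ℤ, d ∣ f.a → d ∣ f.b → d ∣ f.c → IsUnit d) :
    f.Primitive := by
  obtain ⟨ha, hb, hc⟩ := dvd_content.1 (dvd_refl (f.content : ℤ))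
  exact Int.ofNat_isUnit.1 (hf _ ha hb hc) |> Nat.isUnit_iff.1

theorem Primitive.isUnit {f : ModernForm} (hf : f.Primitive) {d : ℤ} (ha : d ∣ f.a) (hb : d ∣ f.b)
    (hc : d ∣ f.c) : IsUnit d := by
  have : d ∣ f.content := dvd_content.2 ⟨ha, hb, hc⟩
  rw [show f.content = 1 from hf] at this
  exact isUnit_of_dvd_one (by simpa using this)

theorem Primitive.bezout {f : ModernForm} (hf : f.Primitive) :
    ∃ x y z : ℤ, f.a * x + f.b * y + f.c * z = 1 := by
  have h₁ := Int.gcd_eq_gcd_ab f.a f.b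
  have h₂ := Int.gcd_eq_gcd_ab (Int.gcd f.a f.b) f.c
  rw [show Int.gcd (Int.gcd f.a f.b) f.c = 1 from hf] at h₂
  rw [Nat.cast_one] at h₂
  generalize Int.gcdA (Int.gcd f.a f.b) f.c = u, Int.gcdB (Int.gcd f.a f.b) f.c = v at h₂
  rw [h₁] at h₂
  exact ⟨Int.gcdA f.a f.b * u, Int.gcdB f.a f.b * u, v, by linear_combination -h₂⟩

theorem posDef_double {f : ModernForm} : f.double.PosDef ↔ f.PosDef := by
  rw [PosDef, PosDef, disc_double]
  exact and_congr_left fun _ => by constructor <;> intro <;> linarith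

theorem primitive_double {f : ModernForm} (ha : Odd f.a) : f.double.Primitive ↔ f.Primitive := by
  refine ⟨fun hf => primitive_of_dvd fun d h₁ h₂ h₃ => hf.isUnit h₁ (h₂.mul_left _) (h₃.mul_left _),
    fun hf => primitive_of_dvd fun d h₁ h₂ h₃ => ?_⟩
  have hd : IsCoprime d 2 :=
    Int.isCoprime_two_right.2 <| Int.not_even_iff_odd.1 fun h₂ =>
      Int.not_even_iff_odd.2 ha (even_iff_two_dvd.2 (h₂.two_dvd.trans h₁))
  refine hf.isUnit h₁ (hd.dvd_of_dvd_mul_left h₂) ?_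
  refine (hd.mul_right hd).dvd_of_dvd_mul_left (?_ : d ∣ 2 * 2 * f.c)
  simpa [double] using h₃

theorem equiv_double_iff {f g : ModernForm} (hf : Odd f.a) : Equiv f.double g.double ↔
    ∃ p q r s : ℤ, p * s - q * r = 1 ∧ Even r ∧ g = f.act p q r s := by
  rw [equiv_iff]
  constructor
  · rintro ⟨p, q, r, s, hd, hfg⟩
    have hq : Even q := by
      have hc : 4 * g.c = f.a * q ^ 2 + 2 * f.b * q * s + 4 * f.c * s ^ 2 :=
        congrArg ModernForm.c hfg
      by_contra hq
      have hodd : Odd (f.a * q ^ 2) := hf.mul (Int.not_even_iff_odd.1 hq).pow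
      have : Even (f.a * q ^ 2) := ⟨2 * g.c - f.b * q * s - 2 * f.c * s ^ 2, by linarith⟩
      exact Int.not_even_iff_odd.2 hodd this
    obtain ⟨q, rfl⟩ := hq
    refine ⟨p, q, 2 * r, s, by linarith, even_two_mul r, ?_⟩
    have h₁ := congrArg ModernForm.a hfg
    have h₂ := congrArg ModernForm.b hfg
    have h₃ := congrArg ModernForm.c hfg
    simp only [double, act, eval] at h₁ h₂ h₃
    apply eq_of_coeff <;> simp only [act, eval] <;> linarith
  · rintro ⟨p, q, r, s, hd, ⟨r, rfl⟩, rfl⟩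
    refine ⟨p, 2 * q, r, s, by linarith, ?_⟩
    apply eq_of_coeff <;> simp only [act, eval, double] <;> ring

/-- A primitive form of discriminant `4 Δ` with `Δ ≡ 1 (mod 4)` is properly equivalent to
`g (x, 2 y)` for a form `g` with odd leading coefficient. -/
theorem exists_equiv_double {f : ModernForm} (hf : f.Primitive) {Δ : ℤ} (hD : f.disc = 4 * Δ)
    (hΔ : Δ % 4 = 1) : ∃ g : ModernForm, Odd g.a ∧ Equiv f g.double := by
  have key : ∀ f : ModernForm, Odd f.a → Even f.b → 4 ∣ f.c →
      ∃ g : ModernForm, Odd g.a ∧ f = g.double := by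
    rintro ⟨a, b, c⟩ ha ⟨b, rfl⟩ ⟨c, rfl⟩
    exact ⟨⟨a, b, c⟩, ha, by simp [double, two_mul]⟩
  suffices ∃ g : ModernForm, Equiv f g ∧ Odd g.a ∧ Even g.b ∧ 4 ∣ g.c by
    obtain ⟨g, hfg, ha, hb, hc⟩ := this
    obtain ⟨g, hg, rfl⟩ := key g ha hb hc
    exact ⟨g, hg, hfg⟩
  obtain ⟨a, b, c⟩ := f
  have hb : Even b := by
    have : Even (b ^ 2) := ⟨2 * (a * c + Δ), by simp only [disc] at hD; linarith⟩
    exact (Int.even_pow.1 this).1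
  obtain ⟨b, rfl⟩ := hb
  have hac : a * c = b ^ 2 - Δ := by simp only [disc] at hD; linarith
  have hnot : ¬ (Even a ∧ Even c) := by
    rintro ⟨ha, hc⟩
    have := hf.isUnit ha.two_dvd (Even.two_dvd ⟨b, rfl⟩) hc.two_dvd
    exact absurd this (by decide)
  rcases Int.even_or_odd b with hb | hb
  · have hb4 : b ^ 2 % 4 = 0 := by
      obtain ⟨k, rfl⟩ := hb
      have : (k + k) ^ 2 = 4 * k ^ 2 := by ring
      lia
    have hac4 : a * c % 4 = 3 := by lia
    refine ⟨_, equiv_act _ (p := 1) (q := 1) (r := 0) (s := 1) (by norm_num), ?_⟩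
    have hmod : a % 4 = 1 ∧ c % 4 = 3 ∨ a % 4 = 3 ∧ c % 4 = 1 := by
      rw [Int.mul_emod] at hac4
      have h₁ := Int.emod_nonneg a (b := 4) (by norm_num)
      have h₂ := Int.emod_lt_of_pos a (b := 4) (by norm_num)
      have h₃ := Int.emod_nonneg c (b := 4) (by norm_num)
      have h₄ := Int.emod_lt_of_pos c (b := 4) (by norm_num)
      interval_cases a % 4 <;> interval_cases c % 4 <;> simp_all
    simp only [act, eval]
    ring_nf
    refine ⟨Int.odd_iff.2 (by lia), Int.even_iff.2 (by lia), by obtain ⟨k, rfl⟩ := hb; lia⟩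
  · have hb4 : b ^ 2 % 4 = 1 := Int.sq_mod_four_eq_one_of_odd hb
    have hac4 : 2 * 2 ∣ a * c := by lia
    have hcop : ∀ {x y : ℤ}, Odd x → 2 * 2 ∣ x * y → 4 ∣ y := by
      intro x y hx hxy
      have : IsCoprime (2 : ℤ) x := (Int.isCoprime_two_left.2 hx)
      exact (this.mul_left this).dvd_of_dvd_mul_left hxy
    rcases Int.even_or_odd a with ha | ha
    · have hc : Odd c := Int.not_even_iff_odd.1 fun hc => hnot ⟨ha, hc⟩
      refine ⟨_, equiv_act _ (p := 0) (q := -1) (r := 1) (s := 0) (by norm_num), ?_⟩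
      have := hcop hc (mul_comm a c ▸ hac4)
      simp only [act, eval]
      ring_nf
      exact ⟨hc, Int.even_iff.2 (by lia), this⟩
    · exact ⟨_, equiv_equivalence.refl _, ha, ⟨b, rfl⟩, hcop ha hac4⟩

/-- Proper automorphs of a primitive form of discriminant less than `-4` are `±1`. -/
theorem automorph_offdiag {f : ModernForm} (hf : f.Primitive) (ha : 0 < f.a) (hD : f.disc < -4)
    {p q r s : ℤ} (hd : p * s - q * r = 1) (hact : f.act p q r s = f) : q = 0 ∧ r = 0 := by
  have h₁ := congrArg ModernForm.a hact
  have h₂ := congrArg ModernForm.b hact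
  have h₃ := congrArg ModernForm.c hact
  simp only [act, eval] at h₁ h₂ h₃
  have e₁ : f.a * q = -(f.c * r) := by
    have : 2 * (f.a * q) = 2 * -(f.c * r) := by
      linear_combination s * h₂ - 2 * r * h₃ - (2 * f.a * q + f.b * s) * hd
    linarith
  have e₂ : f.a * (s - p) = f.b * r := by
    have : 2 * (f.a * (s - p)) = 2 * (f.b * r) := by
      linear_combination r * h₂ - 2 * s * h₁ + (2 * f.a * p + f.b * r) * hd
    linarith
  have hdvd : f.a ∣ r := by
    obtain ⟨x, y, z, hxyz⟩ := hf.bezout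
    refine ⟨r * x + (s - p) * y - q * z, ?_⟩
    linear_combination (-r) * hxyz - y * e₂ + z * e₁
  obtain ⟨u, rfl⟩ := hdvd
  have hq : q = -(f.c * u) := mul_left_cancel₀ ha.ne' (by linarith)
  have hs : s = p + f.b * u := by
    have : s - p = f.b * u := mul_left_cancel₀ ha.ne' (by linarith)
    linarith
  subst hq hs
  have hpell : (2 * p + f.b * u) ^ 2 + (-f.disc) * u ^ 2 = 4 := by
    simp only [disc]; linear_combination 4 * hd
  have hu : u = 0 := by
    by_contra hu
    have : 0 < u ^ 2 := by positivity
    nlinarith [sq_nonneg (2 * p + f.b * u)]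
  simp [hu]

theorem disc_emod_eight {f : ModernForm} (hb : Odd f.b) :
    f.disc % 8 = 1 ∧ Even (f.a * f.c) ∨ f.disc % 8 = 5 ∧ Odd (f.a * f.c) := by
  have h₁ : f.b ^ 2 % 8 = 1 := by
    obtain ⟨k, hk⟩ := hb
    obtain ⟨l, hl⟩ := Int.even_mul_succ_self k
    have : f.b ^ 2 = 8 * l + 1 := by rw [hk]; linear_combination 4 * hl
    lia
  rcases Int.even_or_odd (f.a * f.c) with h₂ | h₂
  · refine Or.inl ⟨?_, h₂⟩
    obtain ⟨k, hk⟩ := h₂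
    simp only [disc, mul_assoc, hk]
    lia
  · refine Or.inr ⟨?_, h₂⟩
    obtain ⟨k, hk⟩ := h₂
    simp only [disc, mul_assoc, hk]
    lia

theorem odd_b {f : ModernForm} (hD : f.disc % 2 = 1) : Odd f.b := by
  refine Int.not_even_iff_odd.1 ?_
  rintro ⟨k, hk⟩
  have : f.disc = 2 * (2 * k ^ 2 - 2 * (f.a * f.c)) := by simp only [disc, hk]; ring
  lia

theorem prim_double_iff {f : ModernForm} (ha : Odd f.a) {Δ : ℤ} :
    (f.double.disc = 4 * Δ ∧ f.double.PosDef ∧ f.double.Primitive) ↔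
      f.disc = Δ ∧ f.PosDef ∧ f.Primitive := by
  rw [posDef_double, primitive_double ha, disc_double]
  exact and_congr_left fun _ => by constructor <;> intro <;> linarith

theorem Equiv.of_double {f g : ModernForm} (hf : Odd f.a) (hfg : Equiv f.double g.double) :
    Equiv f g := by
  obtain ⟨p, q, r, s, hd, -, hg⟩ := (equiv_double_iff hf).1 hfg
  exact equiv_iff.2 ⟨p, q, r, s, hd, hg⟩

/-- `h(4 Δ) = h(Δ)` for `Δ ≡ 1 (mod 8)`. -/
theorem h_four_mul_of_one {Δ : ℤ} (hΔ : Δ % 8 = 1) : h (4 * Δ) = h Δ := by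
  let X := {f : ModernForm // Odd f.a ∧ f.disc = Δ ∧ f.PosDef ∧ f.Primitive}
  let R : X → X → Prop := fun f g => Equiv f.1 g.1
  trans Nat.card (Quot R)
  · symm
    let φ : X → Prim (4 * Δ) := fun f => ⟨f.1.double, (prim_double_iff f.2.1).2 f.2.2⟩
    have hφ : ∀ f g : X, R f g → Equiv (φ f).1 (φ g).1 := by
      rintro ⟨f, hf, hfD, _⟩ ⟨g, hg, _⟩ hfg
      obtain ⟨p, q, r, s, hd, rfl⟩ := equiv_iff.1 hfg
      refine (equiv_double_iff hf).2 ⟨p, q, r, s, hd, ?_, rfl⟩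
      have hb : Odd f.b := odd_b (by lia)
      obtain ⟨-, hac⟩ | ⟨h₅, -⟩ := disc_emod_eight hb
      · obtain ⟨c, hc⟩ := (Int.even_mul.1 hac).resolve_left (Int.not_even_iff_odd.2 hf)
        by_contra hr
        obtain ⟨k, rfl⟩ := Int.not_even_iff_odd.1 hr
        obtain ⟨a, ha⟩ := hf
        obtain ⟨b, hb⟩ := hb
        obtain ⟨t, ht⟩ := Int.even_mul_succ_self p
        refine Int.not_even_iff_odd.2 hg
          ⟨t + a * p ^ 2 + b * p * (2 * k + 1) + k * p + c * (2 * k + 1) ^ 2, ?_⟩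
        simp only [act, eval, ha, hb, hc]
        linear_combination ht
      · lia
    refine Nat.card_congr (_root_.Equiv.ofBijective (Quot.map φ hφ) ⟨?_, ?_⟩)
    · rintro ⟨f⟩ ⟨g⟩ hfg
      exact Quot.sound (Equiv.of_double f.2.1 ((quot_eq_iff (f := φ f) (g := φ g)).1 hfg))
    · rintro ⟨f, hf⟩
      obtain ⟨g, hg, hfg⟩ := exists_equiv_double hf.2.2 hf.1 (by lia)
      exact ⟨Quot.mk _ ⟨g, hg, (prim_double_iff hg).1 (hfg.prim hf)⟩,
        quot_eq_iff.2 (equiv_equivalence.symm hfg)⟩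
  · let φ : X → Prim Δ := fun f => ⟨f.1, f.2.2⟩
    refine Nat.card_congr (_root_.Equiv.ofBijective (Quot.map φ fun _ _ hfg => hfg) ⟨?_, ?_⟩)
    · rintro ⟨f⟩ ⟨g⟩ hfg
      exact Quot.sound ((quot_eq_iff (f := φ f) (g := φ g)).1 hfg)
    · rintro ⟨f, hf⟩
      suffices ∃ g, Equiv f g ∧ Odd g.a by
        obtain ⟨g, hfg, hg⟩ := this
        exact ⟨Quot.mk _ ⟨g, hg, hfg.prim hf⟩, quot_eq_iff.2 (equiv_equivalence.symm hfg)⟩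
      have hb : Odd f.b := odd_b (by lia)
      rcases Int.even_or_odd f.a with ha | ha
      · rcases Int.even_or_odd f.c with hc | hc
        · refine ⟨_, f.equiv_act (p := 1) (q := 0) (r := 1) (s := 1) (by norm_num), ?_⟩
          simp only [act, eval]
          simpa using (ha.add_odd hb).add_even hc
        · refine ⟨_, f.equiv_act (p := 0) (q := -1) (r := 1) (s := 0) (by norm_num), ?_⟩
          simpa [act, eval] using hc
      · exact ⟨f, equiv_equivalence.refl f, ha⟩

/-- Representatives for the left cosets in `SL₂(ℤ)` of the matrices with even lower left entry. -/
def translate (f : ModernForm) : Fin 3 → ModernForm :=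
  ![f.act 1 0 0 1, f.act 0 (-1) 1 0, f.act 1 0 1 1]

theorem equiv_translate (f : ModernForm) (i : Fin 3) : Equiv f (f.translate i) := by
  fin_cases i
  · exact f.equiv_act (by norm_num)
  · exact f.equiv_act (by norm_num)
  · exact f.equiv_act (by norm_num)

theorem exists_translate_act (f : ModernForm) {p q r s : ℤ} (hd : p * s - q * r = 1) :
    ∃ i, ∃ p' q' r' s' : ℤ, p' * s' - q' * r' = 1 ∧ Even r' ∧
      f.act p q r s = (f.translate i).act p' q' r' s' := by
  rcases Int.even_or_odd r with hr | hr
  · exact ⟨0, p, q, r, s, hd, hr, by simp [translate, act_act]⟩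
  rcases Int.even_or_odd p with hp | hp
  · refine ⟨1, r, s, -p, -q, by linarith, hp.neg, ?_⟩
    simp [translate, act_act]
  · refine ⟨2, p, q, r - p, s - q, by linarith, hr.sub_odd hp, ?_⟩
    simp [translate, act_act]

theorem translate_injective {f : ModernForm} (hf : f.Primitive) (ha : 0 < f.a) (hD : f.disc < -4)
    {i j : Fin 3} {p q r s : ℤ} (hd : p * s - q * r = 1) (hr : Even r)
    (hij : f.translate j = (f.translate i).act p q r s) : i = j := by
  have hps : Odd (p * s) := by
    have := (hr.mul_left q).add_odd odd_one
    rwa [show q * r + 1 = p * s by linarith] at this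
  obtain ⟨hp, hs⟩ := Int.odd_mul.1 hps
  have key : ∀ p q r s p' q' r' s' : ℤ, p * s - q * r = 1 → p' * s' - q' * r' = 1 →
      f.act p q r s = f.act p' q' r' s' → q' * p - p' * q = 0 ∧ r' * s - s' * r = 0 := by
    intro p q r s p' q' r' s' hd hd' h
    have h₁ := congrArg (fun g => g.act s (-q) (-r) p) h
    simp only [act_act] at h₁
    have h₂ : f.act (p * s + q * -r) (p * -q + q * p) (r * s + s * -r) (r * -q + s * p) = f := by
      conv_rhs => rw [← f.act_one]
      congr 1 <;> linarith
    rw [h₂] at h₁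
    have h₃ := automorph_offdiag hf ha hD (by linear_combination (p * s - q * r) * hd' + hd) h₁.symm
    constructor <;> linarith
  obtain ⟨k, rfl⟩ := hr
  obtain ⟨l, rfl⟩ := hp
  obtain ⟨m, rfl⟩ := hs
  fin_cases i <;> fin_cases j <;> first
    | rfl
    | dsimp [translate] at hij
      simp only [act_act] at hij
      have := key _ _ _ _ _ _ _ _ (by norm_num) (by linear_combination hd) hij
      lia

/-- `h(4 Δ) = 3 h(Δ)` for `Δ ≡ 5 (mod 8)`, `Δ < -4`. -/
theorem h_four_mul_of_five {Δ : ℤ} (hΔ : Δ % 8 = 5) (hΔ' : Δ < -4) : h (4 * Δ) = 3 * h Δ := by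
  have hodd : ∀ f : ModernForm, f.disc = Δ → Odd f.a := by
    intro f hf
    obtain ⟨h₁, -⟩ | ⟨-, h₁⟩ := disc_emod_eight (odd_b (f := f) (by lia))
    · lia
    · exact (Int.odd_mul.1 h₁).1
  have hprim : ∀ (f : Prim Δ) (i : Fin 3), (f.1.translate i).disc = Δ ∧
      (f.1.translate i).PosDef ∧ (f.1.translate i).Primitive :=
    fun f i => (f.1.equiv_translate i).prim f.2
  let φ : (Quot fun f g : Prim Δ => Equiv f.1 g.1) × Fin 3 →
      Quot fun f g : Prim (4 * Δ) => Equiv f.1 g.1 := fun κ =>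
    Quot.mk _ ⟨(κ.1.out.1.translate κ.2).double,
      (prim_double_iff (hodd _ (hprim _ _).1)).2 (hprim κ.1.out κ.2)⟩
  have hφ : Function.Bijective φ := by
    constructor
    · rintro ⟨κ, i⟩ ⟨μ, j⟩ hκ
      have hdbl := quot_eq_iff.1 hκ
      have hi := hodd _ (hprim κ.out i).1
      have hκμ : κ = μ := by
        rw [← Quot.out_eq κ, ← Quot.out_eq μ]
        exact quot_eq_iff.2 (equiv_equivalence.trans (equiv_translate _ i)
          (equiv_equivalence.trans (hdbl.of_double hi)
            (equiv_equivalence.symm (equiv_translate _ j))))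
      subst hκμ
      obtain ⟨p, q, r, s, hd, hr, hij⟩ := (equiv_double_iff hi).1 hdbl
      rw [translate_injective κ.out.2.2.2 κ.out.2.2.1.2 (κ.out.2.1.trans_lt hΔ') hd hr hij]
    · rintro ⟨f, hf⟩
      obtain ⟨g, hg, hfg⟩ := exists_equiv_double hf.2.2 hf.1 (by lia)
      let κ : Quot fun f g : Prim Δ => Equiv f.1 g.1 :=
        Quot.mk _ ⟨g, (prim_double_iff hg).1 (hfg.prim hf)⟩
      have hκ : Equiv κ.out.1 g := quot_eq_iff.1 (Quot.out_eq κ)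
      obtain ⟨p, q, r, s, hd, hact⟩ := equiv_iff.1 hκ
      obtain ⟨i, p', q', r', s', hd', hr', hact'⟩ := exists_translate_act κ.out.1 hd
      refine ⟨(κ, i), quot_eq_iff.2 (equiv_equivalence.trans ?_ (equiv_equivalence.symm hfg))⟩
      exact (equiv_double_iff (hodd _ (hprim κ.out i).1)).2
        ⟨p', q', r', s', hd', hr', hact.trans hact'⟩
  rw [h, ← Nat.card_congr (_root_.Equiv.ofBijective φ hφ), Nat.card_prod, Nat.card_fin, h, mul_comm]

/-- `h_ω(4 Δ) = h_ω(Δ)` for negative `Δ ≡ 1 (mod 8)`. -/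
theorem hω_four_mul_of_one {Δ : ℤ} (hΔ : Δ % 8 = 1) : hω (4 * Δ) = hω Δ := by
  rw [hω, hω, if_neg (by lia), if_neg (by lia), if_neg (by lia), if_neg (by lia),
    h_four_mul_of_one hΔ]

/-- `h_ω(4 Δ) = 3 h_ω(Δ)` for negative `Δ ≡ 5 (mod 8)`. -/
theorem hω_four_mul_of_five {Δ : ℤ} (hΔ : Δ % 8 = 5) (hΔ₀ : Δ < 0) : hω (4 * Δ) = 3 * hω Δ := by
  rcases eq_or_ne Δ (-3) with rfl | hne
  · norm_num [hω, h_neg_twelve]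
  · rw [hω, hω, if_neg (by lia), if_neg (by lia), if_neg (by lia), if_neg (by lia),
      h_four_mul_of_five hΔ (by lia)]
    push_cast; rfl

end ModernForm

namespace ClassicalForm

/-- The form `(a, 2b, c)` as a modern form. -/
def toModern_s8 (f : ClassicalForm) : ModernForm := ⟨f.a, 2 * f.b, f.c⟩

theorem equiv_iff_toModern {f g : ClassicalForm} :
    Equiv f g ↔ ModernForm.Equiv f.toModern_s8 g.toModern_s8 := Iff.rfl

theorem disc_toModern (f : ClassicalForm) : f.toModern_s8.disc = 4 * f.det := by
  simp only [toModern_s8, ModernForm.disc, det]; ring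

theorem posDef_toModern {f : ClassicalForm} : f.toModern_s8.PosDef ↔ f.PosDef := by
  rw [ModernForm.PosDef, PosDef, disc_toModern]
  exact and_congr_left fun _ => by constructor <;> intro <;> linarith

theorem equiv_equivalence : Equivalence Equiv :=
  ModernForm.equiv_equivalence.comap toModern_s8

end ClassicalForm

namespace ModernForm

theorem content_scale (k : ℕ) (f : ModernForm) : (f.scale k).content = k * f.content := by
  simp only [content, scale, Int.gcd_mul_left, Int.natAbs_natCast, Nat.cast_mul]

theorem equiv_scale {k : ℤ} (hk : k ≠ 0) {f g : ModernForm} :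
    Equiv (f.scale k) (g.scale k) ↔ Equiv f g := by
  simp only [Equiv, eval_scale, mul_right_inj' hk]

theorem posDef_scale {k : ℤ} (hk : 0 < k) {f : ModernForm} : (f.scale k).PosDef ↔ f.PosDef := by
  have hk' : 0 < k ^ 2 := by positivity
  rw [PosDef, PosDef, disc_scale]
  exact and_congr ⟨fun h => (pos_iff_neg_of_mul_neg h).1 hk', fun h => mul_neg_of_pos_of_neg hk' h⟩
    (mul_pos_iff_of_pos_left hk)

theorem exists_eq_scale (f : ModernForm) : ∃ g : ModernForm, f = g.scale f.content := by
  obtain ⟨⟨a, ha⟩, ⟨b, hb⟩, ⟨c, hc⟩⟩ := dvd_content.1 (dvd_refl (f.content : ℤ))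
  exact ⟨⟨a, b, c⟩, eq_of_coeff ha hb hc⟩

theorem classCount_eq_sum (S : Set ClassicalForm) (D : Finset ℕ) (Δ : ℕ → ℤ) (k : ℕ) (hk : 0 < k)
    (hD : ∀ δ ∈ D, 0 < δ)
    (hS : ∀ f, f ∈ S ↔ ∃ δ ∈ D, ∃ g : ModernForm,
      (g.disc = Δ δ ∧ g.PosDef ∧ g.Primitive) ∧ f.toModern_s8 = g.scale (k * δ : ℕ))
    (hlift : ∀ δ ∈ D, ∀ g : ModernForm, (g.disc = Δ δ ∧ g.PosDef ∧ g.Primitive) →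
      ∃ f : ClassicalForm, f.toModern_s8 = g.scale (k * δ : ℕ)) :
    classCount S = ∑ δ ∈ D, h (Δ δ) := by
  have hkδ : ∀ δ ∈ D, ((k * δ : ℕ) : ℤ) ≠ 0 := fun δ hδ => by
    have := hD δ hδ
    positivity
  have : Nonempty ClassicalForm := ⟨⟨0, 0, 0⟩⟩
  choose! lift hlift using hlift
  have hmem : ∀ (δ : D) (g : Prim (Δ δ)), lift δ g.1 ∈ S := fun δ g =>
    (hS _).2 ⟨δ, δ.2, g.1, g.2, hlift δ δ.2 g.1 g.2⟩
  let φ : (Σ δ : D, Quot fun f g : Prim (Δ δ) => Equiv f.1 g.1) →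
      Quot fun f g : S => ClassicalForm.Equiv f.1 g.1 := fun κ =>
    Quot.map (fun g => ⟨lift κ.1 g.1, hmem κ.1 g⟩) (fun f g hfg => by
      rw [ClassicalForm.equiv_iff_toModern, hlift _ κ.1.2 _ f.2, hlift _ κ.1.2 _ g.2]
      exact (equiv_scale (hkδ _ κ.1.2)).2 hfg) κ.2
  have heq : ∀ f g : S, Quot.mk (fun f g : S => ClassicalForm.Equiv f.1 g.1) f = Quot.mk _ g ↔
      ClassicalForm.Equiv f.1 g.1 :=
    Equivalence.quot_mk_eq_iff (ClassicalForm.equiv_equivalence.comap Subtype.val)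
  have hφ : Function.Bijective φ := by
    constructor
    · rintro ⟨⟨δ, hδ⟩, ⟨f⟩⟩ ⟨⟨ε, hε⟩, ⟨g⟩⟩ hfg
      have hfg := (heq _ _).1 hfg
      rw [ClassicalForm.equiv_iff_toModern, hlift δ hδ _ f.2, hlift ε hε _ g.2] at hfg
      have hc := hfg.content_eq
      rw [content_scale, content_scale, show f.1.content = 1 from f.2.2.2,
        show g.1.content = 1 from g.2.2.2, mul_one, mul_one] at hc
      obtain rfl : ε = δ := Nat.eq_of_mul_eq_mul_left hk hc
      rw [quot_eq_iff.2 ((equiv_scale (hkδ _ hδ)).1 hfg)]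
    · rintro ⟨f, hf⟩
      obtain ⟨δ, hδ, g, hg, hfg⟩ := (hS f).1 hf
      refine ⟨⟨⟨δ, hδ⟩, Quot.mk _ ⟨g, hg⟩⟩, (heq _ _).2 ?_⟩
      rw [ClassicalForm.equiv_iff_toModern, hlift δ hδ _ hg, hfg]
      exact equiv_equivalence.refl _
  rw [classCount, ← Nat.card_congr (_root_.Equiv.ofBijective φ hφ), Nat.card_sigma]
  exact Finset.sum_coe_sort D fun δ => h (Δ δ)

end ModernForm

/-- The positive integers whose square divides `n`. -/
noncomputable def squareDivisors (n : ℕ) : Finset ℕ := (Finset.Icc 1 n).filter fun δ => δ ^ 2 ∣ n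

theorem mem_squareDivisors {n : ℕ} (hn : 0 < n) {δ : ℕ} :
    δ ∈ squareDivisors n ↔ 0 < δ ∧ δ ^ 2 ∣ n := by
  simp only [squareDivisors, Finset.mem_filter, Finset.mem_Icc]
  refine ⟨fun h => ⟨h.1.1, h.2⟩, fun h => ⟨⟨h.1, ?_⟩, h.2⟩⟩
  exact (Nat.le_self_pow two_ne_zero δ).trans (Nat.le_of_dvd hn h.2)

namespace ClassicalForm

theorem dvd_divisor {d : ℤ} {f : ClassicalForm} :
    d ∣ f.divisor ↔ d ∣ f.a ∧ d ∣ f.b ∧ d ∣ f.c := by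
  rw [divisor, Int.dvd_coe_gcd_iff, Int.dvd_coe_gcd_iff, and_assoc]

theorem divisor_pos {f : ClassicalForm} (hf : f.PosDef) : 0 < f.divisor :=
  Nat.pos_of_ne_zero fun h => by
    have := (dvd_divisor.1 (dvd_refl (f.divisor : ℤ))).1
    rw [h] at this
    exact hf.2.ne' (by simpa using this)

theorem divisor_sq_dvd (f : ClassicalForm) : (f.divisor : ℤ) ^ 2 ∣ f.det := by
  obtain ⟨ha, hb, hc⟩ := dvd_divisor.1 (dvd_refl (f.divisor : ℤ))
  exact dvd_sub (pow_dvd_pow_of_dvd hb 2) (sq (f.divisor : ℤ) ▸ mul_dvd_mul ha hc)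

theorem mem_iff_exists_scale {n k : ℕ} (hn : 0 < n) (hk : 0 < k)
    {Δ : ℕ → ℤ} (hdiv : ∀ f : ClassicalForm, ∀ δ ∈ squareDivisors n, ∀ g : ModernForm,
      g.disc = Δ δ → g.Primitive → f.toModern_s8 = g.scale (k * δ : ℕ) → f.divisor = δ)
    (hΔ : ∀ δ ∈ squareDivisors n, (k * δ : ℤ) ^ 2 * Δ δ = 4 * -(n : ℤ))
    (f : ClassicalForm) :
    (f.det = -(n : ℤ) ∧ f.PosDef ∧ f.toModern_s8.content = k * f.divisor) ↔
      ∃ δ ∈ squareDivisors n, ∃ g : ModernForm,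
        (g.disc = Δ δ ∧ g.PosDef ∧ g.Primitive) ∧ f.toModern_s8 = g.scale (k * δ : ℕ) := by
  constructor
  · rintro ⟨hdet, hpos, hc⟩
    have hδ : f.divisor ∈ squareDivisors n := by
      refine (mem_squareDivisors hn).2 ⟨divisor_pos hpos, ?_⟩
      have := f.divisor_sq_dvd
      rw [hdet, dvd_neg] at this
      exact_mod_cast this
    have hkδ : 0 < k * f.divisor := Nat.mul_pos hk (divisor_pos hpos)
    obtain ⟨g, hg⟩ := f.toModern_s8.exists_eq_scale
    rw [hc] at hg
    refine ⟨f.divisor, hδ, g, ⟨?_, ?_, ?_⟩, hg⟩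
    · have h₁ := f.disc_toModern
      rw [hg, ModernForm.disc_scale, hdet, ← hΔ _ hδ, Nat.cast_mul] at h₁
      have : ((k : ℤ) * f.divisor) ^ 2 ≠ 0 := by
        have := divisor_pos hpos
        positivity
      exact mul_left_cancel₀ this h₁
    · rw [← posDef_toModern, hg, ModernForm.posDef_scale (by exact_mod_cast hkδ)] at hpos
      exact hpos
    · rw [hg, ModernForm.content_scale] at hc
      exact Nat.eq_of_mul_eq_mul_left hkδ (hc.trans (mul_one _).symm)
  · rintro ⟨δ, hδ, g, ⟨hD, hpos, hprim⟩, hfg⟩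
    have hδ₀ := ((mem_squareDivisors hn).1 hδ).1
    have hdet : f.det = -(n : ℤ) := by
      have h₁ := f.disc_toModern
      rw [hfg, ModernForm.disc_scale, hD, Nat.cast_mul, hΔ _ hδ] at h₁
      linarith
    refine ⟨hdet, ?_, ?_⟩
    · rw [← posDef_toModern, hfg]
      exact (ModernForm.posDef_scale (by exact_mod_cast Nat.mul_pos hk hδ₀)).2 hpos
    · rw [hdiv f δ hδ g hD hprim hfg, hfg, ModernForm.content_scale,
        show g.content = 1 from hprim, mul_one]

/-- The divisor of `f` is `δ` as soon as `δ` divides the coefficients of `f` with coprime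
quotients. -/
theorem divisor_eq {f : ClassicalForm} {δ : ℕ} {x y z : ℤ} (ha : f.a = δ * x) (hb : f.b = δ * y)
    (hc : f.c = δ * z) (hxyz : ∀ d : ℤ, d ∣ x → d ∣ y → d ∣ z → IsUnit d) : f.divisor = δ := by
  have h₁ := ModernForm.primitive_of_dvd (f := ⟨x, y, z⟩) hxyz
  rw [divisor, ha, hb, hc, Int.gcd_mul_left, Nat.cast_mul, Int.natCast_natAbs, Nat.abs_cast,
    Int.gcd_mul_left, show Int.gcd (Int.gcd x y) z = 1 from h₁]
  simp

end ClassicalForm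

theorem squareDivisors_spec {n : ℕ} (hn : 0 < n) {δ : ℕ} (hδ : δ ∈ squareDivisors n) :
    n = δ ^ 2 * (n / δ ^ 2) :=
  (Nat.mul_div_cancel' ((mem_squareDivisors hn).1 hδ).2).symm

theorem cast_squareDivisors_spec {n : ℕ} (hn : 0 < n) {δ : ℕ} (hδ : δ ∈ squareDivisors n) :
    (n : ℤ) = δ ^ 2 * (n / δ ^ 2 : ℕ) := by
  exact_mod_cast squareDivisors_spec hn hδ

theorem div_sq_emod_eight {n : ℕ} (hn : 0 < n) (hmod : n % 4 ≠ 0) {δ : ℕ}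
    (hδ : δ ∈ squareDivisors n) : n / δ ^ 2 % 8 = n % 8 := by
  have h₁ := squareDivisors_spec hn hδ
  rcases Nat.even_or_odd' δ with ⟨k, hk | hk⟩
  · rw [hk, mul_pow, mul_assoc] at h₁
    lia
  · obtain ⟨l, hl⟩ := Nat.even_mul_succ_self k
    have h₂ : δ ^ 2 = 8 * l + 1 := by rw [hk]; linear_combination 4 * hl
    generalize n / δ ^ 2 = m at h₁ ⊢
    rw [h₂, add_mul, mul_assoc] at h₁
    lia

theorem F_eq_sum {n : ℕ} (hn : 0 < n) :
    F n = ∑ δ ∈ squareDivisors n, h (-((4 * (n / δ ^ 2) : ℕ) : ℤ)) := by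
  have heven : ∀ (m : ℕ) (g : ModernForm), g.disc = -((4 * m : ℕ) : ℤ) → ∃ b, g.b = 2 * b := by
    intro m g hg
    have : Even (g.b ^ 2) := ⟨2 * (g.a * g.c - m), by
      simp only [ModernForm.disc] at hg; push_cast at hg; linarith⟩
    exact (Int.even_pow.1 this).1.two_dvd
  refine ModernForm.classCount_eq_sum _ _ (fun δ => -((4 * (n / δ ^ 2) : ℕ) : ℤ)) 1 one_pos
    (fun δ hδ => ((mem_squareDivisors hn).1 hδ).1) ?_ ?_
  · intro f
    rw [← ClassicalForm.mem_iff_exists_scale hn one_pos ?_ ?_, one_mul]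
    · rfl
    · intro f δ hδ g hD hg hfg
      rw [one_mul] at hfg
      obtain ⟨b, hb⟩ := heven _ g hD
      have hb' : 2 * f.b = δ * g.b := congrArg ModernForm.b hfg
      refine ClassicalForm.divisor_eq (x := g.a) (y := b) (z := g.c) (congrArg ModernForm.a hfg) ?_
        (congrArg ModernForm.c hfg) fun d h₁ h₂ h₃ => hg.isUnit h₁ (hb ▸ h₂.mul_left 2) h₃
      rw [hb] at hb'
      linarith
    · intro δ hδ
      rw [cast_squareDivisors_spec hn hδ]
      push_cast
      ring
  · intro δ hδ g hg
    obtain ⟨b, hb⟩ := heven _ g hg.1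
    refine ⟨⟨δ * g.a, δ * b, δ * g.c⟩, ?_⟩
    apply ModernForm.eq_of_coeff <;> simp only [ClassicalForm.toModern_s8, ModernForm.scale, hb] <;>
      push_cast <;> ring

theorem F₁_eq_sum {n : ℕ} (hn : 0 < n) (hmod : n % 4 ≠ 0) :
    F₁ n = ∑ δ ∈ squareDivisors n, h (-((n / δ ^ 2 : ℕ) : ℤ)) := by
  refine ModernForm.classCount_eq_sum _ _ (fun δ => -((n / δ ^ 2 : ℕ) : ℤ)) 2 two_pos
    (fun δ hδ => ((mem_squareDivisors hn).1 hδ).1) ?_ ?_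
  · intro f
    rw [← ClassicalForm.mem_iff_exists_scale hn two_pos ?_ ?_]
    · rfl
    · intro f δ hδ g hD hg hfg
      have hodd : Odd g.b := by
        refine Int.not_even_iff_odd.1 ?_
        rintro ⟨b, hb⟩
        have h₁ := div_sq_emod_eight hn hmod hδ
        have h₂ : (n / δ ^ 2 : ℕ) = 4 * (g.a * g.c - b ^ 2) := by
          simp only [ModernForm.disc, hb] at hD
          linarith
        lia
      have ha : f.a = (2 * δ : ℕ) * g.a := congrArg ModernForm.a hfg
      have hb : 2 * f.b = (2 * δ : ℕ) * g.b := congrArg ModernForm.b hfg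
      have hc : f.c = (2 * δ : ℕ) * g.c := congrArg ModernForm.c hfg
      push_cast at ha hb hc
      refine ClassicalForm.divisor_eq (x := 2 * g.a) (y := g.b) (z := 2 * g.c) (by linarith)
        (by linarith) (by linarith) fun d h₁ h₂ h₃ => ?_
      have hd : IsCoprime d 2 := Int.isCoprime_two_right.2 <| Int.not_even_iff_odd.1 fun h =>
        Int.not_even_iff_odd.2 hodd (even_iff_two_dvd.2 (h.two_dvd.trans h₂))
      exact hg.isUnit (hd.dvd_of_dvd_mul_left h₁) h₂ (hd.dvd_of_dvd_mul_left h₃)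
    · intro δ hδ
      rw [cast_squareDivisors_spec hn hδ]
      push_cast
      ring
  · intro δ _ g _
    refine ⟨⟨2 * δ * g.a, δ * g.b, 2 * δ * g.c⟩, ?_⟩
    apply ModernForm.eq_of_coeff <;> simp only [ClassicalForm.toModern_s8, ModernForm.scale] <;>
      push_cast <;> ring

theorem sum_squareDivisors_ite {n c : ℕ} (hn : 0 < n) (w : ℚ) :
    ∑ δ ∈ squareDivisors n, (if n / δ ^ 2 = c then w else 0) =
      if ∃ t : ℕ, 0 < t ∧ n = c * t ^ 2 then w else 0 := by
  split_ifs with hex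
  · obtain ⟨t, ht, hnt⟩ := hex
    have hc : 0 < c := Nat.pos_of_ne_zero fun hc => by simp [hc] at hnt; lia
    rw [Finset.sum_eq_single t]
    · rw [if_pos]
      rw [hnt, Nat.mul_div_cancel _ (by positivity)]
    · intro δ hδ hne
      rw [if_neg]
      rintro hδc
      have h₁ := squareDivisors_spec hn hδ
      rw [hδc, hnt, mul_comm] at h₁
      exact hne (Nat.pow_left_injective two_ne_zero (Nat.eq_of_mul_eq_mul_right hc h₁)).symm
    · intro htD
      exact absurd ((mem_squareDivisors hn).2 ⟨ht, hnt ▸ dvd_mul_left _ _⟩) htD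
  · refine Finset.sum_eq_zero fun δ hδ => if_neg fun hδc => hex ⟨δ, ?_, ?_⟩
    · exact ((mem_squareDivisors hn).1 hδ).1
    · rw [mul_comm, ← hδc]
      exact squareDivisors_spec hn hδ

theorem Fw_eq_sum {n : ℕ} (hn : 0 < n) :
    Fw n = ∑ δ ∈ squareDivisors n, hω (-((4 * (n / δ ^ 2) : ℕ) : ℤ)) := by
  have hterm : ∀ m : ℕ, hω (-((4 * m : ℕ) : ℤ)) =
      h (-((4 * m : ℕ) : ℤ)) - if m = 1 then 1 / 2 else 0 := by
    intro m
    by_cases hm : m = 1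
    · subst hm
      norm_num [hω, ModernForm.h_neg_four]
    · rw [hω, if_neg (by lia), if_neg (by lia), if_neg hm, sub_zero]
  have hsum := sum_squareDivisors_ite (c := 1) hn (1 / 2)
  simp only [one_mul] at hsum
  simp only [hterm, Finset.sum_sub_distrib, hsum]
  rw [Fw, F_eq_sum hn, Nat.cast_sum]

theorem F₁w_eq_sum {n : ℕ} (hn : 0 < n) (hmod : n % 4 ≠ 0) :
    F₁w n = ∑ δ ∈ squareDivisors n, hω (-((n / δ ^ 2 : ℕ) : ℤ)) := by
  have hterm : ∀ δ ∈ squareDivisors n, hω (-((n / δ ^ 2 : ℕ) : ℤ)) =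
      h (-((n / δ ^ 2 : ℕ) : ℤ)) - if n / δ ^ 2 = 3 then 2 / 3 else 0 := by
    intro δ hδ
    have h₁ := div_sq_emod_eight hn hmod hδ
    generalize n / δ ^ 2 = m at h₁ ⊢
    by_cases hm : m = 3
    · subst hm
      norm_num [hω, ModernForm.h_neg_three]
    · rw [hω, if_neg (by lia), if_neg (by lia), if_neg hm, sub_zero]
  rw [Finset.sum_congr rfl hterm, Finset.sum_sub_distrib, sum_squareDivisors_ite hn, F₁w,
    F₁_eq_sum hn hmod, Nat.cast_sum]

theorem hω_eq_zero {m : ℕ} (hm : m % 4 = 1 ∨ m % 4 = 2) : hω (-(m : ℤ)) = 0 := by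
  rw [hω, if_neg (by lia), if_neg (by lia), h, Nat.cast_eq_zero, Nat.card_eq_zero]
  refine Or.inl ⟨?_⟩
  rintro ⟨⟨f, hf, -⟩⟩
  simp only [ModernForm.disc, mul_assoc] at hf
  have h₄ : f.b ^ 2 % 4 = 0 ∨ f.b ^ 2 % 4 = 1 := by
    rcases Int.even_or_odd f.b with ⟨k, hk⟩ | hb
    · left
      rw [hk, show (k + k) ^ 2 = 4 * k ^ 2 by ring]
      lia
    · exact Or.inr (Int.sq_mod_four_eq_one_of_odd hb)
  generalize f.a * f.c = x at hf
  lia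

theorem Hur_eq_sum {n : ℕ} (hn : 0 < n) (hmod : n % 4 = 3) :
    Hur n = ∑ δ ∈ squareDivisors n, hω (-((n / δ ^ 2 : ℕ) : ℤ)) := by
  refine Finset.sum_congr (Finset.ext fun δ => ?_) fun _ _ => rfl
  rw [squareDivisors, Finset.mem_filter, Finset.mem_filter]
  refine ⟨fun h => ⟨h.1, h.2.1⟩, fun h => ⟨h.1, h.2, Or.inr ?_⟩⟩
  have := div_sq_emod_eight hn (by lia) (Finset.mem_filter.2 h)
  lia

theorem Hur_four_mul_eq_sum {n : ℕ} (hn : 0 < n) (hmod : n % 4 = 1 ∨ n % 4 = 2) :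
    Hur (4 * n) = ∑ δ ∈ squareDivisors n, hω (-((4 * (n / δ ^ 2) : ℕ) : ℤ)) := by
  refine Finset.sum_congr (Finset.ext fun δ => ?_) fun δ hδ => ?_
  · rw [mem_squareDivisors hn, Finset.mem_filter, Finset.mem_Icc]
    constructor
    · rintro ⟨⟨hδ, -⟩, hdvd, hres⟩
      refine ⟨hδ, ?_⟩
      rcases Nat.even_or_odd' δ with ⟨k, rfl | hk⟩
      · exfalso
        rw [mul_pow, show 2 ^ 2 = 4 from rfl] at hdvd hres
        have hk : k ∈ squareDivisors n := (mem_squareDivisors hn).2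
          ⟨by lia, Nat.dvd_of_mul_dvd_mul_left (by norm_num) hdvd⟩
        have h₁ := div_sq_emod_eight hn (by lia) hk
        rw [Nat.mul_div_mul_left _ _ (by norm_num)] at hres
        lia
      · have hcop : Nat.Coprime (δ ^ 2) (2 ^ 2) :=
          Nat.Coprime.pow 2 2 (Nat.coprime_two_right.2 ⟨k, hk⟩)
        exact hcop.dvd_of_dvd_mul_left hdvd
    · rintro ⟨hδ, hdvd⟩
      have hle := (Nat.le_self_pow two_ne_zero δ).trans (Nat.le_of_dvd hn hdvd)
      refine ⟨⟨hδ, by lia⟩, hdvd.mul_left 4, Or.inl ?_⟩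
      rw [Nat.mul_div_assoc _ hdvd]
      lia
  · rw [Nat.mul_div_assoc _ ((mem_squareDivisors hn).1 hδ).2]

/-- for `n ≢ 0 (mod 4)`, the weighted class counts satisfy
`F(n) - F₁(n) = H(4n)` if `n ≡ 1, 2 (mod 4)`, `F(n) - F₁(n) = 2 H(n)` if
`n ≡ 3 (mod 8)`, and `F(n) - F₁(n) = 0` if `n ≡ 7 (mod 8)`. -/
theorem Fw_sub_F₁w_eq_hurwitz (n : ℕ) (hn : 0 < n) (hmod : n % 4 ≠ 0) :
    ((n % 4 = 1 ∨ n % 4 = 2) → Fw n - F₁w n = Hur (4 * n)) ∧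
    (n % 8 = 3 → Fw n - F₁w n = 2 * Hur n) ∧
    (n % 8 = 7 → Fw n - F₁w n = 0) := by
  have h₁ : n % 4 ≠ 3 → F₁w n = 0 := fun h => by
    rw [F₁w_eq_sum hn hmod]
    refine Finset.sum_eq_zero fun δ hδ => hω_eq_zero ?_
    have := div_sq_emod_eight hn hmod hδ
    lia
  refine ⟨fun h => ?_, fun h => ?_, fun h => ?_⟩
  · rw [h₁ (by lia), sub_zero, Fw_eq_sum hn, Hur_four_mul_eq_sum hn h]
  · have key : Fw n = 3 * F₁w n := by
      rw [Fw_eq_sum hn, F₁w_eq_sum hn hmod, Finset.mul_sum]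
      refine Finset.sum_congr rfl fun δ hδ => ?_
      have := div_sq_emod_eight hn hmod hδ
      rw [← ModernForm.hω_four_mul_of_five (by lia) (by lia), Nat.cast_mul, Nat.cast_ofNat, mul_neg]
    rw [key, Hur_eq_sum hn (by lia), ← F₁w_eq_sum hn hmod]
    ring
  · rw [sub_eq_zero, Fw_eq_sum hn, F₁w_eq_sum hn hmod]
    refine Finset.sum_congr rfl fun δ hδ => ?_
    have := div_sq_emod_eight hn hmod hδ
    rw [← ModernForm.hω_four_mul_of_one (Δ := -((n / δ ^ 2 : ℕ) : ℤ)) (by lia), Nat.cast_mul,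
      Nat.cast_ofNat, mul_neg]
end
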